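/- arXiv:2212.06652 — 2 statements merged into one kernel-verified Lean document; each statement's English description precedes it below -/
import Mathlib

section
/- Fix k ∈ ℕ ∪ {∞} and let U be a nonempty open subset of ℝ. Let R = C^k(ℝ), let S = C^k(U), let ψ : R → S be the ring homomorphism given by restriction of functions to U, and let M = {a ∈ R | U ⊆ coz a}, a multiplicatively closed subset (submonoid) of R. Then every element of ψ(M) is invertible in S, and every f ∈ S can be written as f = ψ(h)·ψ(g)⁻¹ for some g ∈ M and h ∈ R; that is, S together with ψ is the localization of R at M (IsLocalization M S). -/
noncomputable section

/-- The cozero set of a function. -/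
def coz (f : ℝ → ℝ) : Set ℝ := {x | f x ≠ 0}

/-- The ring `C^k(ℝ)` of `k`-times continuously differentiable functions `ℝ → ℝ`,
as a subring of the ring of all functions `ℝ → ℝ` with pointwise operations. -/
def Ck (k : ℕ∞) : Subring (ℝ → ℝ) where
  carrier := {f | ContDiff ℝ k f}
  one_mem' := show ContDiff ℝ k (fun _ => (1 : ℝ)) from contDiff_const
  mul_mem' := fun {a b} ha hb => show ContDiff ℝ k (a * b) from ContDiff.mul ha hb
  zero_mem' := show ContDiff ℝ k (fun _ => (0 : ℝ)) from contDiff_const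
  add_mem' := fun {a b} ha hb => show ContDiff ℝ k (a + b) from ContDiff.add ha hb
  neg_mem' := fun {a} ha => show ContDiff ℝ k (-a) from ContDiff.neg ha

/-- A function `f : U → ℝ` on an open set `U ⊆ ℝ` is `C^k` if some (equivalently,
since `ContDiffOn` only depends on values on `U`, any) extension of it to `ℝ`
is `ContDiffOn ℝ k` on `U`. -/
def IsCkOn (k : ℕ∞) (U : Set ℝ) (f : ↥U → ℝ) : Prop :=
  ∃ F : ℝ → ℝ, ContDiffOn ℝ k F U ∧ ∀ x : U, F x = f x

/-- The ring `C^k(U)` of `k`-times continuously differentiable functions `U → ℝ`,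
as a subring of the ring of all functions `↥U → ℝ` with pointwise operations. -/
def CkOn (k : ℕ∞) (U : Set ℝ) : Subring (↥U → ℝ) where
  carrier := {f | IsCkOn k U f}
  one_mem' := ⟨fun _ => 1, contDiffOn_const, fun _ => rfl⟩
  mul_mem' := fun {a b} ha hb => by
    obtain ⟨F, hF, hFa⟩ := ha; obtain ⟨G, hG, hGb⟩ := hb
    exact ⟨F * G, hF.mul hG, fun x => by
      simp only [Pi.mul_apply, hFa x, hGb x]⟩
  zero_mem' := ⟨fun _ => 0, contDiffOn_const, fun _ => rfl⟩
  add_mem' := fun {a b} ha hb => by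
    obtain ⟨F, hF, hFa⟩ := ha; obtain ⟨G, hG, hGb⟩ := hb
    exact ⟨F + G, hF.add hG, fun x => by
      simp only [Pi.add_apply, hFa x, hGb x]⟩
  neg_mem' := fun {a} ha => by
    obtain ⟨F, hF, hFa⟩ := ha
    exact ⟨-F, hF.neg, fun x => by simp only [Pi.neg_apply, hFa x]⟩

/-- The restriction ring homomorphism `ψ : C^k(ℝ) → C^k(U)`. -/
def restrictHom (k : ℕ∞) (U : Set ℝ) : Ck k →+* CkOn k U where
  toFun f := ⟨fun x => f.1 x, f.1, ContDiff.contDiffOn f.2, fun _ => rfl⟩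
  map_one' := rfl
  map_mul' _ _ := rfl
  map_zero' := rfl
  map_add' _ _ := rfl

instance algebraCkOn (k : ℕ∞) (U : Set ℝ) : Algebra (Ck k) (CkOn k U) :=
  (restrictHom k U).toAlgebra

/-- The multiplicatively closed subset `M = {a ∈ C^k(ℝ) | U ⊆ coz a}`. -/
def cozSubmonoid (k : ℕ∞) (U : Set ℝ) : Submonoid (Ck k) where
  carrier := {a | U ⊆ coz a.1}
  one_mem' := fun _ _ => one_ne_zero
  mul_mem' := fun {a b} ha hb x hx =>
    show a.1 x * b.1 x ≠ 0 from mul_ne_zero (ha hx) (hb hx)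

open Set Function in
/-- Any sequence of compactly supported `C^n` functions can be rescaled by positive factors so that
its sum converges pointwise to a `C^n` function. -/
theorem exists_pos_contDiff_tsum_smul {E F : Type*} [NormedAddCommGroup E] [NormedSpace ℝ E]
    [NormedAddCommGroup F] [NormedSpace ℝ F] [CompleteSpace F] {n : ℕ∞} {u : ℕ → E → F}
    (hu : ∀ j, ContDiff ℝ n (u j)) (hsupp : ∀ j, HasCompactSupport (u j)) :
    ∃ r : ℕ → ℝ, (∀ j, 0 < r j) ∧ (∀ x, Summable fun j => r j • u j x) ∧
      ContDiff ℝ n fun x => ∑' j, r j • u j x := by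
  have bounded : ∀ j i : ℕ, ∃ R : ℝ, 0 ≤ R ∧
      ((i : ℕ∞) ≤ n → ∀ x, ‖iteratedFDeriv ℝ i (u j) x‖ ≤ R) := by
    intro j i
    by_cases hi : (i : ℕ∞) ≤ n
    · obtain ⟨R, hR⟩ := ((hu j).continuous_iteratedFDeriv
        (mod_cast hi)).norm.bddAbove_range_of_hasCompactSupport
          (((hsupp j).iteratedFDeriv i).comp_left norm_zero)
      exact ⟨R, (norm_nonneg _).trans (hR (mem_range_self 0)), fun _ x => hR (mem_range_self x)⟩
    · exact ⟨0, le_rfl, fun h => absurd h hi⟩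
  choose R R_nonneg hR using bounded
  let M : ℕ → ℝ := fun j => 1 + ∑ i ∈ Finset.range (j + 1), R j i
  have M_pos : ∀ j, 0 < M j := fun j =>
    add_pos_of_pos_of_nonneg one_pos (Finset.sum_nonneg fun i _ => R_nonneg j i)
  have R_le_M : ∀ j i, i ≤ j → R j i ≤ M j := by
    intro j i hij
    have := Finset.single_le_sum (f := R j) (fun i _ => R_nonneg j i)
      (Finset.mem_range.2 (Nat.lt_succ_of_le hij))
    exact this.trans (le_add_of_nonneg_left zero_le_one)
  let r : ℕ → ℝ := fun j => (1 / 2 : ℝ) ^ j / M j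
  have r_pos : ∀ j, 0 < r j := fun j => div_pos (by positivity) (M_pos j)
  have deriv_le : ∀ i j : ℕ, (i : ℕ∞) ≤ n → i ≤ j → ∀ x,
      ‖iteratedFDeriv ℝ i (fun x => r j • u j x) x‖ ≤ (1 / 2 : ℝ) ^ j := by
    intro i j hi hij x
    have hsmul : iteratedFDeriv ℝ i (fun x => r j • u j x) x =
        r j • iteratedFDeriv ℝ i (u j) x :=
      iteratedFDeriv_const_smul_apply ((hu j).contDiffAt.of_le (mod_cast hi))
    rw [hsmul, norm_smul, Real.norm_of_nonneg (r_pos j).le]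
    calc r j * ‖iteratedFDeriv ℝ i (u j) x‖ ≤ r j * M j :=
          mul_le_mul_of_nonneg_left ((hR j i hi x).trans (R_le_M j i hij)) (r_pos j).le
      _ = (1 / 2 : ℝ) ^ j := div_mul_cancel₀ _ (M_pos j).ne'
  refine ⟨r, r_pos, fun x => ?_, ?_⟩
  · refine Summable.of_norm_bounded summable_geometric_two fun j => ?_
    simpa only [norm_iteratedFDeriv_zero] using deriv_le 0 j (by simp) (Nat.zero_le j) x
  · refine contDiff_tsum_of_eventually (v := fun _ j => (1 / 2 : ℝ) ^ j)
      (fun j => (hu j).const_smul (r j)) (fun _ _ => summable_geometric_two) fun i hi => ?_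
    rw [Nat.cofinite_eq_atTop]
    exact Filter.eventually_atTop.2 ⟨i, fun j hij x => deriv_le i j (mod_cast hi) hij x⟩

open Set Function in
/-- A nonempty open set is covered by the supports of a sequence of nonnegative smooth functions
with compact support inside it. -/
theorem IsOpen.exists_seq_contDiff_tsupport_subset {E : Type*} [NormedAddCommGroup E]
    [NormedSpace ℝ E] [FiniteDimensional ℝ E] (n : ℕ∞) {s : Set E} (hs : IsOpen s)
    (hne : s.Nonempty) :
    ∃ φ : ℕ → E → ℝ, (∀ j, ContDiff ℝ n (φ j)) ∧ (∀ j, HasCompactSupport (φ j)) ∧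
      (∀ j, tsupport (φ j) ⊆ s) ∧ (∀ j x, 0 ≤ φ j x) ∧ ∀ x ∈ s, ∃ j, 0 < φ j x := by
  have bump : ∀ x : s, ∃ f : E → ℝ, tsupport f ⊆ s ∧ HasCompactSupport f ∧ ContDiff ℝ n f ∧
      range f ⊆ Icc 0 1 ∧ f x = 1 := fun x => exists_contDiff_tsupport_subset (hs.mem_nhds x.2)
  choose f f_tsupp f_comp f_smooth f_range f_one using bump
  obtain ⟨T, T_count, hT⟩ := TopologicalSpace.isOpen_iUnion_countable (fun x : s => support (f x))
    fun x => (f_smooth x).continuous.isOpen_support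
  have cover : ∀ x ∈ s, ∃ y ∈ T, f y x ≠ 0 := by
    intro x hx
    have : x ∈ ⋃ y : s, support (f y) :=
      mem_iUnion.2 ⟨⟨x, hx⟩, by simp [f_one ⟨x, hx⟩]⟩
    rw [← hT] at this
    simpa using this
  obtain ⟨x₀, hx₀⟩ := hne
  obtain ⟨y₀, hy₀, -⟩ := cover x₀ hx₀
  obtain ⟨e, rfl⟩ := T_count.exists_eq_range ⟨y₀, hy₀⟩
  have f_nonneg : ∀ y x, 0 ≤ f y x := fun y x => (f_range y (mem_range_self x)).1
  refine ⟨fun j => f (e j), fun j => f_smooth _, fun j => f_comp _, fun j => f_tsupp _,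
    fun j => f_nonneg _, fun x hx => ?_⟩
  obtain ⟨-, ⟨j, rfl⟩, hj⟩ := cover x hx
  exact ⟨j, (f_nonneg _ x).lt_of_ne' hj⟩

/-- The product of a `C^n` function supported in an open set `s` with a function that is `C^n` on
`s` is `C^n` everywhere. -/
theorem ContDiff.smul_contDiffOn_of_tsupport_subset {E F : Type*} [NormedAddCommGroup E]
    [NormedSpace ℝ E] [NormedAddCommGroup F] [NormedSpace ℝ F] {n : ℕ∞} {s : Set E} {φ : E → ℝ}
    {f : E → F} (hφ : ContDiff ℝ n φ) (hf : ContDiffOn ℝ n f s) (hs : IsOpen s)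
    (hsupp : tsupport φ ⊆ s) : ContDiff ℝ n fun x => φ x • f x := by
  refine contDiff_iff_contDiffAt.2 fun x => ?_
  by_cases hx : x ∈ s
  · exact hφ.contDiffAt.smul (hf.contDiffAt (hs.mem_nhds hx))
  · have hzero := notMem_tsupport_iff_eventuallyEq.1 fun h => hx (hsupp h)
    refine (contDiffAt_const (c := (0 : F))).congr_of_eventuallyEq ?_
    filter_upwards [hzero] with y hy
    simp [hy]

/-- A function that is `C^n` on a nonempty open set `s` becomes, after multiplication by a suitable
`C^n` function which is positive on `s`, the restriction of a globally `C^n` function. -/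
theorem ContDiffOn.exists_contDiff_pos_smul_eqOn {E F : Type*} [NormedAddCommGroup E]
    [NormedSpace ℝ E] [FiniteDimensional ℝ E] [NormedAddCommGroup F] [NormedSpace ℝ F]
    [CompleteSpace F] {n : ℕ∞} {s : Set E} {f : E → F} (hf : ContDiffOn ℝ n f s) (hs : IsOpen s)
    (hne : s.Nonempty) :
    ∃ (g : E → ℝ) (h : E → F), ContDiff ℝ n g ∧ ContDiff ℝ n h ∧ (∀ x ∈ s, 0 < g x) ∧
      ∀ x, g x • f x = h x := by
  obtain ⟨φ, φ_smooth, φ_comp, φ_supp, φ_nonneg, φ_pos⟩ :=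
    hs.exists_seq_contDiff_tsupport_subset n hne
  obtain ⟨r, r_pos, r_summable, r_smooth⟩ :=
    exists_pos_contDiff_tsum_smul (u := fun j x => (φ j x, φ j x • f x))
      (fun j => (φ_smooth j).prodMk
        ((φ_smooth j).smul_contDiffOn_of_tsupport_subset hf hs (φ_supp j)))
      (fun j => (φ_comp j).mono' fun x hx => subset_tsupport _ fun h0 => hx (by simp [h0]))
  have fst_eq : ∀ x, (∑' j, r j • (φ j x, φ j x • f x)).1 = ∑' j, r j * φ j x := fun x =>
    (ContinuousLinearMap.fst ℝ ℝ F).map_tsum (r_summable x)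
  have snd_eq : ∀ x, (∑' j, r j • (φ j x, φ j x • f x)).2 = ∑' j, r j • φ j x • f x := fun x =>
    (ContinuousLinearMap.snd ℝ ℝ F).map_tsum (r_summable x)
  have summable_fst : ∀ x, Summable fun j => r j * φ j x := fun x =>
    (ContinuousLinearMap.fst ℝ ℝ F).summable (r_summable x)
  refine ⟨_, _, r_smooth.fst, r_smooth.snd, fun x hx => ?_, fun x => ?_⟩
  · obtain ⟨j, hj⟩ := φ_pos x hx
    rw [fst_eq]
    exact (summable_fst x).tsum_pos (fun i => mul_nonneg (r_pos i).le (φ_nonneg i x)) j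
      (mul_pos (r_pos j) hj)
  · rw [fst_eq, snd_eq, ← (summable_fst x).tsum_smul_const]
    simp only [mul_smul]

theorem isUnit_restrictHom {k : ℕ∞} {U : Set ℝ} {g : Ck k} (hg : g ∈ cozSubmonoid k U) :
    IsUnit (restrictHom k U g) := by
  refine IsUnit.of_mul_eq_one
    ⟨fun x => (g.1 x)⁻¹, fun x => (g.1 x)⁻¹, ContDiffOn.inv (ContDiff.contDiffOn g.2) fun x hx => hg hx,
      fun _ => rfl⟩ ?_
  ext x
  exact mul_inv_cancel₀ (hg x.2)

theorem exists_mul_restrictHom_eq {k : ℕ∞} {U : Set ℝ} (hU : IsOpen U) (hUne : U.Nonempty)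
    (f : CkOn k U) : ∃ g ∈ cozSubmonoid k U, ∃ h : Ck k,
      f * restrictHom k U g = restrictHom k U h := by
  obtain ⟨F, hF, hFf⟩ := f.2
  obtain ⟨g, h, hg, hh, g_pos, hgh⟩ := hF.exists_contDiff_pos_smul_eqOn hU hUne
  refine ⟨⟨g, hg⟩, fun x hx => (g_pos x hx).ne', ⟨h, hh⟩, ?_⟩
  ext x
  change f.1 x * g x = h x
  rw [← hgh, ← hFf, smul_eq_mul, mul_comm]

theorem exists_mul_eq_of_restrictHom_eq {k : ℕ∞} {U : Set ℝ} (hU : IsOpen U) {a b : Ck k}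
    (hab : restrictHom k U a = restrictHom k U b) : ∃ c : cozSubmonoid k U, c * a = c * b := by
  obtain ⟨c, c_supp, hc, -⟩ := hU.exists_contDiff_support_eq (n := k)
  refine ⟨⟨⟨c, hc⟩, c_supp.ge⟩, ?_⟩
  ext x
  change c x * a.1 x = c x * b.1 x
  by_cases hx : x ∈ U
  · have : a.1 x = b.1 x := congrFun (congrArg Subtype.val hab) ⟨x, hx⟩
    rw [this]
  · have : c x = 0 := Function.notMem_support.1 (c_supp ▸ hx)
    rw [this, zero_mul, zero_mul]

/-- For `k ∈ ℕ ∪ {∞}` and a nonempty open `U ⊆ ℝ`, the restriction map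
`ψ : C^k(ℝ) → C^k(U)` sends every member of `M = {a | U ⊆ coz a}` to a unit,
every `f ∈ C^k(U)` is of the form `ψ h ⬝ (ψ g)⁻¹` with `g ∈ M`, and `C^k(U)`
is the localization of `C^k(ℝ)` at `M`. -/
theorem stmt7 (k : ℕ∞) (U : Set ℝ) (hU : IsOpen U) (hUne : U.Nonempty) :
    (∀ g ∈ cozSubmonoid k U, IsUnit (restrictHom k U g)) ∧
    (∀ f : CkOn k U, ∃ g ∈ cozSubmonoid k U, ∃ h : Ck k,
        f * restrictHom k U g = restrictHom k U h) ∧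
    IsLocalization (cozSubmonoid k U) (CkOn k U) := by
  refine ⟨fun _ => isUnit_restrictHom, exists_mul_restrictHom_eq hU hUne,
    (isLocalization_iff _ _).2 ⟨fun g => isUnit_restrictHom g.2, fun f => ?_,
      exists_mul_eq_of_restrictHom_eq hU⟩⟩
  obtain ⟨g, hg, h, hgh⟩ := exists_mul_restrictHom_eq hU hUne f
  exact ⟨(h, ⟨g, hg⟩), hgh⟩
end
end

section
/- Let k ∈ ℕ. Suppose f : ℝ → ℝ is C^k on ℝ and there is a dense open set V ⊆ ℝ such that f is C^{k+1} on V (ContDiffOn ℝ (k+1) f V). Then there exist g, h : ℝ → ℝ, both C^{k+1} on ℝ, such that coz g is dense in ℝ, V ⊆ coz g, and f(x)·g(x) = h(x) for every x ∈ ℝ. (Hence f lies in the classical ring of quotients of C^{k+1}(ℝ).) -/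
noncomputable section

open Function Topology

section

variable {E : Type*} [NormedAddCommGroup E] [NormedSpace ℝ E]

/-- The product of a function that is `C^n` on an open set `V` with a `C^n` function whose
topological support is contained in `V` is `C^n` everywhere. -/
theorem ContDiffOn.contDiff_mul_of_tsupport_subset {n : WithTop ℕ∞} {f φ : E → ℝ} {V : Set E}
    (hf : ContDiffOn ℝ n f V) (hV : IsOpen V) (hφ : ContDiff ℝ n φ) (hsupp : tsupport φ ⊆ V) :
    ContDiff ℝ n (fun x => f x * φ x) := by
  rw [contDiff_iff_contDiffAt]
  intro x
  by_cases hx : x ∈ tsupport φ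
  · exact (hf.contDiffAt (hV.mem_nhds (hsupp hx))).mul hφ.contDiffAt
  · have h0 : (fun y => f y * φ y) =ᶠ[𝓝 x] fun _ => 0 := by
      filter_upwards [notMem_tsupport_iff_eventuallyEq.1 hx] with y hy
      simp [hy]
    exact contDiffAt_const.congr_of_eventuallyEq h0

/-- The derivatives up to order `m` of a compactly supported `C^m` function are uniformly
bounded. -/
theorem HasCompactSupport.exists_forall_norm_iteratedFDeriv_le {m : ℕ} {φ : E → ℝ}
    (hc : HasCompactSupport φ) (hφ : ContDiff ℝ m φ) :
    ∃ C : ℝ, ∀ i ≤ m, ∀ x, ‖_root_.iteratedFDeriv ℝ i φ x‖ ≤ C := by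
  have hbound : ∀ i, ∃ R : ℝ, i ≤ m → ∀ x, ‖_root_.iteratedFDeriv ℝ i φ x‖ ≤ R := by
    intro i
    by_cases hi : i ≤ m
    · obtain ⟨R, hR⟩ := (hφ.continuous_iteratedFDeriv (mod_cast hi)).bounded_above_of_compact_support
        (hc.iteratedFDeriv i)
      exact ⟨R, fun _ => hR⟩
    · exact ⟨0, fun h => absurd h hi⟩
  choose R hR using hbound
  obtain ⟨C, hC⟩ := ((Finset.range (m + 1)).image R).bddAbove
  refine ⟨C, fun i hi x => (hR i hi x).trans (hC ?_)⟩
  exact Finset.mem_coe.2 (Finset.mem_image_of_mem R (Finset.mem_range.2 (Nat.lt_succ_of_le hi)))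

/-- All sufficiently small nonnegative multiples of a compactly supported `C^m` function have their
derivatives up to order `m` bounded by a prescribed positive constant. -/
theorem HasCompactSupport.exists_pos_forall_norm_iteratedFDeriv_smul_le {m : ℕ} {φ : E → ℝ}
    (hc : HasCompactSupport φ) (hφ : ContDiff ℝ m φ) {ε : ℝ} (hε : 0 < ε) :
    ∃ r : ℝ, 0 < r ∧ ∀ s, 0 ≤ s → s ≤ r → ∀ i ≤ m, ∀ x,
      ‖_root_.iteratedFDeriv ℝ i (s • φ) x‖ ≤ ε := by
  obtain ⟨C, hC⟩ := hc.exists_forall_norm_iteratedFDeriv_le hφ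
  have hM : 0 < max C 1 := lt_max_of_lt_right one_pos
  refine ⟨ε / max C 1, div_pos hε hM, fun s hs0 hs i hi x => ?_⟩
  rw [iteratedFDeriv_const_smul_apply (hφ.contDiffAt.of_le (mod_cast hi)), norm_smul,
    Real.norm_of_nonneg hs0]
  calc s * ‖_root_.iteratedFDeriv ℝ i φ x‖ ≤ ε / max C 1 * max C 1 := by
        gcongr
        exact (hC i hi x).trans (le_max_left _ _)
    _ = ε := div_mul_cancel₀ _ hM.ne'

/-- A function that is `C^m` on an open set `V` becomes `C^m` everywhere after multiplication by
some `C^m` function whose support is exactly `V`. -/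
theorem ContDiffOn.exists_contDiff_support_eq_contDiff_mul [FiniteDimensional ℝ E] {m : ℕ}
    {f : E → ℝ} {V : Set E} (hf : ContDiffOn ℝ m f V) (hV : IsOpen V) :
    ∃ g : E → ℝ, ContDiff ℝ m g ∧ support g = V ∧ ContDiff ℝ m (fun x => f x * g x) := by
  have hbump : ∀ p : V, ∃ φ : E → ℝ, tsupport φ ⊆ V ∧ HasCompactSupport φ ∧ ContDiff ℝ m φ ∧
      (∀ x, 0 ≤ φ x) ∧ φ p = 1 := by
    intro p
    obtain ⟨φ, hsupp, hc, hφ, hrange, hp⟩ :=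
      exists_contDiff_tsupport_subset (n := (m : ℕ∞)) (hV.mem_nhds p.2)
    exact ⟨φ, hsupp, hc, mod_cast hφ, fun x => (hrange ⟨x, rfl⟩).1, hp⟩
  choose φ hsupp hc hφ hφ0 hφ1 using hbump
  obtain ⟨T, hT, hTV⟩ := TopologicalSpace.isOpen_iUnion_countable (fun p : V => support (φ p))
    (fun p => (hφ p).continuous.isOpen_support)
  have : Countable T := hT.to_subtype
  obtain ⟨δ, hδ, c, hδc, -⟩ := NNReal.exists_pos_sum_of_countable one_ne_zero T
  have hδsum : Summable fun p => (δ p : ℝ) := (NNReal.hasSum_coe.2 hδc).summable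
  have hfφ : ∀ p, ContDiff ℝ m (fun x => f x * φ p x) := fun p =>
    hf.contDiff_mul_of_tsupport_subset hV (hφ p) (hsupp p)
  have hscale : ∀ p : T, ∃ r : ℝ, 0 < r ∧
      (∀ i ≤ m, ∀ x, ‖iteratedFDeriv ℝ i (r • φ p) x‖ ≤ δ p) ∧
      ∀ i ≤ m, ∀ x, ‖iteratedFDeriv ℝ i (r • fun y => f y * φ p y) x‖ ≤ δ p := by
    intro p
    have hδp : (0 : ℝ) < δ p := hδ p
    obtain ⟨r₁, hr₁, h₁⟩ :=
      (hc p).exists_pos_forall_norm_iteratedFDeriv_smul_le (hφ p) hδp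
    obtain ⟨r₂, hr₂, h₂⟩ :=
      ((hc p).mul_left (f := f)).exists_pos_forall_norm_iteratedFDeriv_smul_le (hfφ p) hδp
    have hr : 0 < min r₁ r₂ := lt_min hr₁ hr₂
    exact ⟨min r₁ r₂, hr, h₁ _ hr.le (min_le_left _ _), h₂ _ hr.le (min_le_right _ _)⟩
  choose r hr hrφ hrf using hscale
  have hsum : ∀ x, Summable fun p : T => (r p • φ p) x := fun x =>
    .of_norm_bounded hδsum fun p => by
      simpa only [norm_iteratedFDeriv_zero] using hrφ p 0 (Nat.zero_le m) x
  have hmul : ∀ x, f x * ∑' p : T, (r p • φ p) x =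
      ∑' p : T, (r p • fun y => f y * φ p y) x := fun x => by
    rw [← tsum_mul_left]
    exact tsum_congr fun p => mul_left_comm _ _ _
  refine ⟨fun x => ∑' p : T, (r p • φ p) x, ?_, ?_, ?_⟩
  · exact contDiff_tsum (N := (m : ℕ∞)) (fun p => (hφ p).const_smul (r p)) (fun _ _ => hδsum)
      fun i p x hi => hrφ p i (mod_cast hi) x
  · refine Set.Subset.antisymm (fun x hx => ?_) fun x hx => ?_
    · by_contra hxV
      refine hx ?_
      have h0 : ∀ p, φ p x = 0 := fun p =>
        notMem_support.1 fun h => hxV (hsupp p (subset_tsupport _ h))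
      simp [h0]
    · have hx' : x ∈ ⋃ p ∈ T, support (φ p) := by
        rw [hTV]
        exact Set.mem_iUnion.2 ⟨⟨x, hx⟩, by simp [hφ1 ⟨x, hx⟩]⟩
      obtain ⟨p, hpT, hp⟩ := Set.mem_iUnion₂.1 hx'
      refine ((hsum x).tsum_pos (fun q => mul_nonneg (hr q).le (hφ0 q x)) ⟨p, hpT⟩ ?_).ne'
      exact mul_pos (hr _) (lt_of_le_of_ne (hφ0 p x) (Ne.symm hp))
  · simp_rw [hmul]
    exact contDiff_tsum (N := (m : ℕ∞)) (fun p => (hfφ p).const_smul (r p)) (fun _ _ => hδsum)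
      fun i p x hi => hrf p i (mod_cast hi) x

end

/-- If `f` is `C^k` on `ℝ` and `C^{k+1}` on a dense open `V`, then there are
`g, h` of class `C^{k+1}` on `ℝ` with `coz g` dense, `V ⊆ coz g`, and
`f * g = h` everywhere; hence `f ∈ Q_cl(C^{k+1}(ℝ))`. -/
theorem stmt16 (k : ℕ) (f : ℝ → ℝ) (hf : ContDiff ℝ k f) (V : Set ℝ)
    (hV : IsOpen V) (hVd : Dense V) (hfV : ContDiffOn ℝ (k + 1) f V) :
    ∃ g h : ℝ → ℝ, ContDiff ℝ (k + 1) g ∧ ContDiff ℝ (k + 1) h ∧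
      Dense (coz g) ∧ V ⊆ coz g ∧ ∀ x, f x * g x = h x := by
  obtain ⟨g, hg, hgV, hfg⟩ :=
    ContDiffOn.exists_contDiff_support_eq_contDiff_mul (m := k + 1) (mod_cast hfV) hV
  have hcoz : coz g = V := hgV
  exact ⟨g, fun x => f x * g x, mod_cast hg, mod_cast hfg, hcoz ▸ hVd, hcoz.ge, fun _ => rfl⟩
end
end
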